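/- Let 0 < r < 1 and R > 0. Then there exists a constant C > 0 such that for all z₁, z₂ ∈ ℂ whose trajectories stay bounded by R, i.e. |h(c, z₁)| ≤ R and |h(c, z₂)| ≤ R for every c with |c| ≤ r, and for every c with |c| ≤ r, one has the Hölder estimate |h(c, z₂) − h(c, z₁)| ≤ C |z₂ − z₁|^{(1 − |c|)/(1 + |c|)}. -/

import Mathlib

/-- `h` is a holomorphic motion of `E ⊆ ℂ` parametrized by the disk `Δ_r = {|c| < r}`
with base point `0`: `h 0 z = z` on `E`; `z ↦ h c z` is injective on `E` for each
`c ∈ Δ_r`; and `c ↦ h c z` is holomorphic on `Δ_r` for each `z ∈ E`. -/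
def IsHolomorphicMotion (r : ℝ) (E : Set ℂ) (h : ℂ → ℂ → ℂ) : Prop :=
  (∀ z ∈ E, h 0 z = z) ∧
  (∀ c ∈ Metric.ball (0 : ℂ) r, Set.InjOn (fun z => h c z) E) ∧
  (∀ z ∈ E, DifferentiableOn ℂ (fun c => h c z) (Metric.ball (0 : ℂ) r))

open Filter Topology in
/-- Ahlfors' argument at a point: a holomorphic map between hyperbolic disks fixing the origin
cannot have a local maximum of its hyperbolic dilation with value greater than `1` there. -/
lemma not_eventually_hyperbolic_dilation_le {ψ : ℂ → ℂ} (h0 : ψ 0 = 0) (ha : 1 < ‖deriv ψ 0‖)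
    (hd : ∀ᶠ c in 𝓝 0, DifferentiableAt ℂ ψ c) :
    ¬ ∀ᶠ c in 𝓝 0, (1 - ‖c‖ ^ 2) * ‖deriv ψ c‖ ≤ ‖deriv ψ 0‖ * (1 - ‖ψ c‖ ^ 2) := by
  intro hle
  set A := deriv ψ 0 with hA
  have hA0 : A ≠ 0 := by
    rintro h
    simp [h] at ha
    linarith
  have han : AnalyticAt ℂ ψ 0 := Complex.analyticAt_iff_eventually_differentiableAt.2 hd
  obtain ⟨p, hp⟩ := han
  have hk : AnalyticAt ℂ (dslope ψ 0) 0 := hp.has_fpower_series_dslope_fslope.analyticAt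
  have hk1 : AnalyticAt ℂ (fun c => dslope ψ 0 c / A) 0 := hk.div analyticAt_const hA0
  have hd1 : AnalyticAt ℂ (fun c => deriv ψ c / A) 0 := hp.analyticAt.deriv.div analyticAt_const hA0
  have e1 : ∀ᶠ c in 𝓝 (0:ℂ), AnalyticAt ℂ (fun c => Complex.log (dslope ψ 0 c / A)) c := by
    refine (hk1.clog ?_).eventually_analyticAt
    simp [← hA, hA0]
  have e2 : ∀ᶠ c in 𝓝 (0:ℂ), AnalyticAt ℂ (fun c => Complex.log (deriv ψ c / A)) c := by
    refine (hd1.clog ?_).eventually_analyticAt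
    simp [← hA, hA0]
  have e3 : ∀ᶠ c in 𝓝 (0:ℂ), dslope ψ 0 c / A ≠ 0 :=
    hk1.continuousAt.eventually_ne (by simp [← hA, hA0])
  have e4 : ∀ᶠ c in 𝓝 (0:ℂ), deriv ψ c / A ≠ 0 :=
    hd1.continuousAt.eventually_ne (by simp [← hA, hA0])
  obtain ⟨ε, hε, hall⟩ := Metric.eventually_nhds_iff_ball.1
    (e1.and (e2.and (e3.and (e4.and hle))))
  set a := ‖A‖ with ha_def
  have ha0 : 0 < a := by linarith
  obtain ⟨s, hs0, hsε, hsa⟩ : ∃ s : ℝ, 0 < s ∧ s < ε ∧ a * s < 1 := by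
    refine ⟨min (ε / 2) (1 / (2 * a)), by positivity, ?_, ?_⟩
    · exact (min_le_left _ _).trans_lt (by linarith)
    · calc a * min (ε / 2) (1 / (2 * a)) ≤ a * (1 / (2 * a)) := by gcongr; exact min_le_right _ _
        _ = 1 / 2 := by field_simp
        _ < 1 := by norm_num
  set B := a ^ 2 * s ^ 2 with hB
  have hB1 : B < 1 := by
    have : B = (a * s) ^ 2 := by ring
    rw [this]; exact pow_lt_one₀ (by positivity) hsa (by norm_num)
  have hsB : s ^ 2 < B := by
    have : 1 < a ^ 2 := one_lt_pow₀ ha (by norm_num)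
    nlinarith [pow_pos hs0 2]
  set m : ℝ := 2 * (B / (1 - B)) with hm
  set E : ℂ → ℂ := fun c => Complex.log (deriv ψ c / A) + m * Complex.log (dslope ψ 0 c / A)
  have hsub : ∀ c ∈ Metric.closedBall (0:ℂ) s, c ∈ Metric.ball (0:ℂ) ε := fun c hc =>
    Metric.closedBall_subset_ball hsε hc
  have hEd : DiffContOnCl ℂ (fun c => Complex.exp (E c)) (Metric.ball 0 s) := by
    refine DifferentiableOn.diffContOnCl fun c hc => ?_
    rw [closure_ball _ hs0.ne'] at hc
    obtain ⟨h1, h2, -⟩ := hall c (hsub c hc)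
    exact ((h2.differentiableAt.add (h1.differentiableAt.const_mul _)).cexp).differentiableWithinAt
  obtain ⟨z, hz, hmax⟩ := Complex.exists_mem_frontier_isMaxOn_norm Metric.isBounded_ball
    ⟨0, Metric.mem_ball_self hs0⟩ hEd
  have hz0 : ‖Complex.exp (E 0)‖ ≤ ‖Complex.exp (E z)‖ :=
    hmax (subset_closure (Metric.mem_ball_self hs0))
  rw [frontier_ball _ hs0.ne', mem_sphere_zero_iff_norm] at hz
  obtain ⟨-, -, h3, h4, h5⟩ := hall z (hsub z (by simp [hz]))
  have hE0 : E 0 = 0 := by simp [E, ← hA, hA0]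
  have hEz : 0 ≤ (E z).re := by
    rw [hE0, Complex.norm_exp, Complex.norm_exp] at hz0
    simpa using Real.exp_le_exp.1 hz0
  have hEre : (E z).re = Real.log (‖deriv ψ z‖ / a) + m * Real.log (‖dslope ψ 0 z‖ / a) := by
    simp [E, Complex.log_re, ha_def]
  set d := ‖deriv ψ z‖
  set k := ‖dslope ψ 0 z‖ / a with hkdef
  have hz_ne : z ≠ 0 := by
    rintro rfl
    simp at hz
    exact hs0.ne hz
  have hψz : ‖ψ z‖ = s * (a * k) := by
    have : ψ z = z * dslope ψ 0 z := by
      rw [dslope_of_ne _ hz_ne, slope_def_field, h0]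
      field_simp
      ring
    rw [this, norm_mul, hz, hkdef]
    field_simp
  have hd0 : 0 < d := by
    refine norm_pos_iff.2 fun h => h4 (by simp [h])
  have hk0 : 0 < k := by
    have : 0 < ‖dslope ψ 0 z / A‖ := norm_pos_iff.2 h3
    simpa [hkdef, ha_def] using this
  have hs1 : s ^ 2 < 1 := hsB.trans hB1
  rw [hψz, hz] at h5
  have hsq : (s * (a * k)) ^ 2 = B * k ^ 2 := by rw [hB]; ring
  rw [hsq] at h5
  have hpos : 0 < 1 - B * k ^ 2 := by
    have : 0 < a * (1 - B * k ^ 2) := lt_of_lt_of_le (mul_pos (by linarith) hd0) h5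
    exact (mul_pos_iff_of_pos_left ha0).1 this
  have hlog := Real.log_le_log (mul_pos (by linarith) hd0) h5
  rw [Real.log_mul (by linarith) hd0.ne', Real.log_mul ha0.ne' hpos.ne'] at hlog
  rw [hEre, Real.log_div hd0.ne' ha0.ne'] at hEz
  have hlk : m * Real.log k = (B / (1 - B)) * Real.log (k ^ 2) := by
    rw [Real.log_pow, hm]; push_cast; ring
  have h1B : 0 < 1 - B := by linarith
  have key : Real.log (1 - B * k ^ 2) ≤ Real.log (1 - B) - (B / (1 - B)) * Real.log (k ^ 2) := by
    have t1 : Real.log ((1 - B * k ^ 2) / (1 - B)) ≤ (1 - B * k ^ 2) / (1 - B) - 1 :=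
      Real.log_le_sub_one_of_pos (by positivity)
    rw [Real.log_div hpos.ne' h1B.ne'] at t1
    have t2 : Real.log (k ^ 2) ≤ k ^ 2 - 1 := Real.log_le_sub_one_of_pos (by positivity)
    have t3 : (1 - B * k ^ 2) / (1 - B) - 1 = (B / (1 - B)) * (1 - k ^ 2) := by
      field_simp; ring
    have hB0 : 0 ≤ B / (1 - B) := by positivity
    nlinarith [mul_le_mul_of_nonneg_left t2 hB0]
  have hlt : Real.log (1 - B) < Real.log (1 - s ^ 2) := Real.log_lt_log h1B (by linarith)
  linarith

open Filter Topology Metric in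
/-- If the hyperbolic derivative bound of Schwarz–Pick type for maps to the right half-plane holds
on the level set `Re W = κ`, then it holds on the superlevel set `Re W ≥ κ`. This is for functions
that extend beyond the closed unit disk. -/
lemma halfPlane_dilation_le_of_differentiableOn {W : ℂ → ℂ} {ρ κ : ℝ} (hρ : 1 < ρ) (hκ : 0 < κ)
    (hW : DifferentiableOn ℂ W (ball 0 ρ))
    (hb : ∀ c : ℂ, ‖c‖ < 1 → (W c).re = κ → (1 - ‖c‖ ^ 2) * ‖deriv W c‖ ≤ 2 * κ)
    {c : ℂ} (hc : ‖c‖ < 1) (hκc : κ ≤ (W c).re) :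
    (1 - ‖c‖ ^ 2) * ‖deriv W c‖ ≤ 2 * (W c).re := by
  by_contra! hcon
  set S := closedBall (0 : ℂ) 1 ∩ {c | κ ≤ (W c).re} with hS
  have hsub : closedBall (0 : ℂ) 1 ⊆ ball 0 ρ := closedBall_subset_ball hρ
  have hWc : ContinuousOn W (closedBall 0 1) := hW.continuousOn.mono hsub
  have hScpt : IsCompact S := by
    refine (isCompact_closedBall (0 : ℂ) 1).of_isClosed_subset ?_ Set.inter_subset_left
    exact (Complex.continuous_re.comp_continuousOn hWc).preimage_isClosed_of_isClosed
      isClosed_closedBall isClosed_Ici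
  set σ : ℂ → ℝ := fun c => (1 - ‖c‖ ^ 2) * ‖deriv W c‖ / (2 * (W c).re) with hσ
  have hdW : ContinuousOn (deriv W) S :=
    ((hW.deriv isOpen_ball).continuousOn.mono hsub).mono Set.inter_subset_left
  have hσc : ContinuousOn σ S := by
    refine ContinuousOn.div (by fun_prop) ?_ ?_
    · exact continuousOn_const.mul
        (Complex.continuous_re.comp_continuousOn (hWc.mono Set.inter_subset_left))
    · intro x hx
      have : κ ≤ (W x).re := hx.2
      have : 0 < (W x).re := by linarith
      positivity
  have hcS : c ∈ S := ⟨by simp [hc.le], hκc⟩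
  obtain ⟨w, hwS, hmax⟩ := hScpt.exists_isMaxOn ⟨c, hcS⟩ hσc
  have hσc1 : 1 < σ c := by
    rw [hσ]; simp only
    rw [one_lt_div (by linarith)]; exact hcon
  have hσw : 1 < σ w := hσc1.trans_le (hmax hcS)
  have hwκ : κ ≤ (W w).re := hwS.2
  have hw0 : 0 < (W w).re := by linarith
  have hw1' : ‖w‖ ≤ 1 := by simpa using hwS.1
  have hw1 : ‖w‖ < 1 := by
    refine lt_of_le_of_ne hw1' fun h => ?_
    simp [hσ, h] at hσw
    linarith
  have hwκ' : κ < (W w).re := by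
    refine lt_of_le_of_ne hwκ fun h => ?_
    have := hb w hw1 h.symm
    rw [hσ] at hσw; simp only at hσw
    rw [one_lt_div (by linarith), ← h] at hσw
    linarith
  set b := (starRingEnd ℂ) w with hbdef
  set φ : ℂ → ℂ := fun c => (c + w) / (1 + b * c) with hφ
  have hbw : b * w = ((‖w‖ ^ 2 : ℝ) : ℂ) := by
    rw [hbdef, mul_comm, Complex.mul_conj, Complex.normSq_eq_norm_sq]
  have hnb : ‖b‖ = ‖w‖ := by simp [hbdef]
  have hden : ∀ c : ℂ, ‖c‖ < 1 → 1 + b * c ≠ 0 := by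
    intro c hc h
    have h1 : b * c = -1 := by linear_combination h
    have h2 : ‖b * c‖ = 1 := by rw [h1]; simp
    rw [norm_mul, hnb] at h2
    nlinarith [norm_nonneg w, norm_nonneg c]
  have hφd : ∀ c : ℂ, ‖c‖ < 1 → HasDerivAt φ ((1 - ‖w‖ ^ 2 : ℝ) / (1 + b * c) ^ 2) c := by
    intro c hc
    have h1 : HasDerivAt (fun c : ℂ => c + w) 1 c := (hasDerivAt_id c).add_const w
    have h2 : HasDerivAt (fun c : ℂ => 1 + b * c) b c := by
      simpa using ((hasDerivAt_id c).const_mul b).const_add 1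
    convert! h1.div h2 (hden c hc) using 1
    congr 1
    push_cast
    push_cast at hbw
    linear_combination hbw
  have hφn : ∀ c : ℂ, ‖c‖ < 1 →
      1 - ‖φ c‖ ^ 2 = (1 - ‖w‖ ^ 2) * (1 - ‖c‖ ^ 2) / ‖1 + b * c‖ ^ 2 := by
    intro c hc
    have h0 : ‖1 + b * c‖ ^ 2 ≠ 0 := by simpa using hden c hc
    rw [hφ]; simp only
    rw [norm_div, div_pow, eq_div_iff h0, sub_mul, div_mul_cancel₀ _ h0]
    simp only [← Complex.normSq_eq_norm_sq, Complex.normSq_apply, hbdef]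
    simp
    ring
  have hφ0 : φ 0 = w := by simp [hφ]
  have hφc : ContinuousAt φ 0 := (hφd 0 (by simp)).continuousAt
  set ω := W w with hω
  set ψ : ℂ → ℂ := fun c => (W (φ c) - ω) / (W (φ c) + (starRingEnd ℂ) ω) with hψ
  have hev : ∀ᶠ c in 𝓝 (0:ℂ), ‖c‖ < 1 ∧ ‖φ c‖ < 1 ∧ κ < (W (φ c)).re := by
    have hWw : ContinuousAt W w := (hW.differentiableAt
      (isOpen_ball.mem_nhds (hsub hwS.1))).continuousAt
    have h3 : ContinuousAt (fun c => (W (φ c)).re) 0 := by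
      refine Complex.continuous_re.continuousAt.comp (ContinuousAt.comp ?_ hφc)
      rwa [hφ0]
    refine (continuous_norm.continuousAt.eventually_lt continuousAt_const (by simp)).and
      ((hφc.norm.eventually_lt continuousAt_const (by simpa [hφ0] using hw1)).and
        (continuousAt_const.eventually_lt h3 (by rw [hφ0]; exact hwκ')))
  have hder : ∀ c : ℂ, ‖c‖ < 1 → ‖φ c‖ < 1 → κ < (W (φ c)).re →
      HasDerivAt ψ (deriv W (φ c) * ((1 - ‖w‖ ^ 2 : ℝ) / (1 + b * c) ^ 2) * (2 * ω.re : ℝ)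
        / (W (φ c) + (starRingEnd ℂ) ω) ^ 2) c := by
    intro c h1 h2 h3
    have hWφ : HasDerivAt (fun c => W (φ c))
        (deriv W (φ c) * ((1 - ‖w‖ ^ 2 : ℝ) / (1 + b * c) ^ 2)) c := by
      have : HasDerivAt W (deriv W (φ c)) (φ c) := (hW.differentiableAt
        (isOpen_ball.mem_nhds (hsub (by simpa using h2.le)))).hasDerivAt
      exact this.comp c (hφd c h1)
    have hne : W (φ c) + (starRingEnd ℂ) ω ≠ 0 := by
      intro h
      have := congrArg Complex.re h
      simp at this
      linarith
    convert! (hWφ.sub_const ω).div (hWφ.add_const ((starRingEnd ℂ) ω)) hne using 1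
    congr 1
    rw [← Complex.add_conj]
    ring
  have hψn : ∀ c : ℂ, κ < (W (φ c)).re →
      1 - ‖ψ c‖ ^ 2 = 4 * ω.re * (W (φ c)).re / ‖W (φ c) + (starRingEnd ℂ) ω‖ ^ 2 := by
    intro c h3
    have hne : W (φ c) + (starRingEnd ℂ) ω ≠ 0 := by
      intro h
      have := congrArg Complex.re h
      simp at this
      linarith
    have h0 : ‖W (φ c) + (starRingEnd ℂ) ω‖ ^ 2 ≠ 0 := by simpa using hne
    rw [hψ]; simp only
    rw [norm_div, div_pow, eq_div_iff h0, sub_mul, div_mul_cancel₀ _ h0]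
    simp only [← Complex.normSq_eq_norm_sq, Complex.normSq_apply]
    simp
    ring
  have hratio : ∀ c : ℂ, ‖c‖ < 1 → ‖φ c‖ < 1 → κ < (W (φ c)).re →
      (1 - ‖c‖ ^ 2) * ‖deriv ψ c‖ = σ (φ c) * (1 - ‖ψ c‖ ^ 2) := by
    intro c h1 h2 h3
    have hp : 0 < (W (φ c)).re := by linarith
    rw [(hder c h1 h2 h3).deriv, hψn c h3, hσ]
    simp only [norm_mul, norm_div, norm_pow, Complex.norm_real]
    rw [hφn c h1, Real.norm_of_nonneg (by nlinarith [norm_nonneg w]),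
      Real.norm_two, Real.norm_of_nonneg hw0.le]
    have := norm_pos_iff.2 (hden c h1)
    field_simp
    ring
  have hψ0 : ψ 0 = 0 := by simp [hψ, hφ0, hω]
  have hψ0' : ‖deriv ψ 0‖ = σ w := by
    have := hratio 0 (by simp) (by rwa [hφ0]) (by rwa [hφ0])
    rw [hψ0, hφ0] at this
    simpa using this
  refine not_eventually_hyperbolic_dilation_le hψ0 (by rw [hψ0']; exact hσw) ?_ ?_
  · filter_upwards [hev] with c hc
    exact (hder c hc.1 hc.2.1 hc.2.2).differentiableAt
  · filter_upwards [hev] with c hc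
    rw [hratio c hc.1 hc.2.1 hc.2.2, hψ0']
    refine mul_le_mul_of_nonneg_right (hmax ⟨by simpa using hc.2.1.le, hc.2.2.le⟩) ?_
    rw [hψn c hc.2.2]
    have : 0 < (W (φ c)).re := by linarith [hc.2.2]
    positivity

open Filter Topology Metric in
/-- If the hyperbolic derivative bound of Schwarz–Pick type for maps to the right half-plane holds
on the level set `Re W = κ`, then it holds on the superlevel set `Re W ≥ κ`. -/
lemma halfPlane_dilation_le {W : ℂ → ℂ} {κ : ℝ} (hκ : 0 < κ)
    (hW : DifferentiableOn ℂ W (ball 0 1))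
    (hb : ∀ c : ℂ, ‖c‖ < 1 → (W c).re = κ → (1 - ‖c‖ ^ 2) * ‖deriv W c‖ ≤ 2 * κ)
    {c : ℂ} (hc : ‖c‖ < 1) (hκc : κ ≤ (W c).re) :
    (1 - ‖c‖ ^ 2) * ‖deriv W c‖ ≤ 2 * (W c).re := by
  have key : ∀ ρ : ℝ, ‖c‖ < ρ → ρ < 1 →
      (1 - (‖c‖ / ρ) ^ 2) * (ρ * ‖deriv W c‖) ≤ 2 * (W c).re := by
    intro ρ hcρ hρ1
    have hρ0 : 0 < ρ := (norm_nonneg c).trans_lt hcρ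
    have hρC : (ρ : ℂ) ≠ 0 := by exact_mod_cast hρ0.ne'
    have hder : ∀ x : ℂ, deriv (fun x => W (ρ * x)) x = ρ * deriv W (ρ * x) := by
      intro x
      simpa using deriv_comp_mul_left (ρ : ℂ) W x
    have h := halfPlane_dilation_le_of_differentiableOn (W := fun x => W (ρ * x)) (ρ := 1 / ρ)
      (κ := κ) (c := c / ρ) (by rw [lt_div_iff₀ hρ0]; linarith) hκ ?_ ?_ ?_ ?_
    · rw [hder] at h
      simp only [mul_div_cancel₀ c hρC, norm_div, norm_mul, Complex.norm_real,
        Real.norm_of_nonneg hρ0.le] at h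
      exact h
    · refine hW.comp (by fun_prop) fun x hx => ?_
      rw [mem_ball_zero_iff, lt_div_iff₀ hρ0] at hx
      simpa [abs_of_pos hρ0, mul_comm] using hx
    · intro x hx hre
      rw [hder, norm_mul, Complex.norm_real, Real.norm_of_nonneg hρ0.le]
      have hlt : ‖(ρ : ℂ) * x‖ < 1 := by
        rw [norm_mul, Complex.norm_real, Real.norm_of_nonneg hρ0.le]
        nlinarith [norm_nonneg x]
      refine le_trans ?_ (hb _ hlt hre)
      rw [norm_mul, Complex.norm_real, Real.norm_of_nonneg hρ0.le, ← mul_assoc]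
      refine mul_le_mul_of_nonneg_right ?_ (norm_nonneg _)
      have hx2 : ‖x‖ ^ 2 ≤ 1 := pow_le_one₀ (norm_nonneg x) hx.le
      nlinarith [mul_nonneg (sub_nonneg.2 hρ1.le) (mul_nonneg hρ0.le (sq_nonneg ‖x‖))]
    · rw [norm_div, Complex.norm_real, Real.norm_of_nonneg hρ0.le, div_lt_one hρ0]
      exact hcρ
    · simpa [mul_div_cancel₀ c hρC] using hκc
  have hlim : Tendsto (fun ρ : ℝ => (1 - (‖c‖ / ρ) ^ 2) * (ρ * ‖deriv W c‖)) (𝓝[<] 1)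
      (𝓝 ((1 - (‖c‖ / 1) ^ 2) * (1 * ‖deriv W c‖))) := by
    refine (ContinuousAt.tendsto ?_).mono_left nhdsWithin_le_nhds
    have : ContinuousAt (fun ρ : ℝ => ‖c‖ / ρ) 1 :=
      continuousAt_const.div continuousAt_id one_ne_zero
    fun_prop
  have := le_of_tendsto hlim (b := 2 * (W c).re) (by
    filter_upwards [Ioo_mem_nhdsLT hc] with ρ hρ using key ρ hρ.1 hρ.2)
  simpa using this

open Filter Topology Metric in
/-- A version of **Bloch's theorem**: the image of the unit disk under a holomorphic function `g`
contains a disk of radius `‖g' 0‖ / 128`. -/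
lemma exists_ball_subset_image_ball {g : ℂ → ℂ} (hg : DifferentiableOn ℂ g (ball 0 1)) :
    ∃ q : ℂ, ball q (‖deriv g 0‖ / 128) ⊆ g '' ball 0 1 := by
  rcases eq_or_ne (deriv g 0) 0 with h0 | h0
  · exact ⟨0, by simp [h0]⟩
  have hsub : closedBall (0 : ℂ) (1 / 2) ⊆ ball 0 1 := closedBall_subset_ball (by norm_num)
  have hg' : DifferentiableOn ℂ (deriv g) (ball 0 1) := hg.deriv isOpen_ball
  obtain ⟨p, hp, hmax⟩ := (isCompact_closedBall (0 : ℂ) (1 / 2)).exists_isMaxOn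
    (f := fun z => ‖deriv g z‖ * (1 / 2 - ‖z‖)) ⟨0, by simp⟩ (by
      have := hg'.continuousOn.mono hsub
      fun_prop)
  have hM : ‖deriv g 0‖ / 2 ≤ ‖deriv g p‖ * (1 / 2 - ‖p‖) := by
    have := hmax (show (0:ℂ) ∈ closedBall (0 : ℂ) (1 / 2) by simp)
    simp at this ⊢
    linarith
  have hd0 : 0 < ‖deriv g 0‖ := norm_pos_iff.2 h0
  have hp' : ‖p‖ ≤ 1 / 2 := by simpa using hp
  set A := ‖deriv g p‖ with hA
  have hA0 : 0 < A := by
    by_contra! h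
    nlinarith [norm_nonneg p, norm_nonneg (deriv g p)]
  have hpt : 0 < 1 / 2 - ‖p‖ := by
    by_contra! h
    nlinarith
  set t := (1 / 2 - ‖p‖) / 2 with ht
  have ht0 : 0 < t := by positivity
  have hball : ball p t ⊆ closedBall (0 : ℂ) (1 / 2) := by
    intro z hz
    rw [mem_ball_iff_norm] at hz
    have : ‖z‖ ≤ ‖z - p‖ + ‖p‖ := by simpa using norm_add_le (z - p) p
    simp
    linarith
  have hdb : ∀ z ∈ ball p t, ‖deriv g z‖ ≤ 2 * A := by
    intro z hz
    have h1 := hmax (hball hz)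
    simp only [← hA] at h1
    rw [mem_ball_iff_norm] at hz
    have : ‖z‖ ≤ ‖z - p‖ + ‖p‖ := by simpa using norm_add_le (z - p) p
    have h2 : t ≤ 1 / 2 - ‖z‖ := by linarith
    have h3 : ‖deriv g z‖ * t ≤ (2 * A) * t := by
      calc ‖deriv g z‖ * t ≤ ‖deriv g z‖ * (1 / 2 - ‖z‖) := by gcongr
        _ ≤ A * (1 / 2 - ‖p‖) := h1
        _ = _ := by rw [ht]; ring
    exact le_of_mul_le_mul_right h3 ht0
  have hschw : ∀ z ∈ ball p t, ‖deriv g z - deriv g p‖ ≤ 3 * A / t * ‖z - p‖ := by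
    intro z hz
    have := Complex.dist_le_div_mul_dist_of_mapsTo_ball (f := deriv g) (c := p) (R₁ := t)
      (R₂ := 3 * A) (hg'.mono (hball.trans hsub)) (fun y hy => ?_) hz
    · simpa [dist_eq_norm] using this
    · rw [mem_closedBall_iff_norm]
      linarith [norm_sub_le (deriv g y) (deriv g p), hdb y hy]
  have hlin : ∀ z ∈ closedBall p (t / 8),
      ‖(g z - deriv g p * z) - (g p - deriv g p * p)‖ ≤ 3 * A / 8 * ‖z - p‖ := by
    intro z hz
    refine (convex_closedBall p (t / 8)).norm_image_sub_le_of_norm_hasDerivWithin_le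
      (f := fun z => g z - deriv g p * z) (f' := fun z => deriv g z - deriv g p) ?_ ?_
      (mem_closedBall_self (by positivity)) hz
    · intro x hx
      have hx' : x ∈ ball p t := closedBall_subset_ball (by linarith) hx
      have h1 : HasDerivAt g (deriv g x) x := (hg.differentiableAt
        (isOpen_ball.mem_nhds (hsub (hball hx')))).hasDerivAt
      have h2 := (h1.sub ((hasDerivAt_id x).const_mul (deriv g p))).hasDerivWithinAt
        (s := closedBall p (t / 8))
      rw [mul_one] at h2
      exact h2
    · intro x hx
      have hx' : x ∈ ball p t := closedBall_subset_ball (by linarith) hx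
      refine (hschw x hx').trans ?_
      rw [mem_closedBall_iff_norm] at hx
      calc 3 * A / t * ‖x - p‖ ≤ 3 * A / t * (t / 8) := by gcongr
        _ = _ := by field_simp
  have hlow : ∀ z ∈ sphere p (t / 8), A * t / 16 ≤ ‖g z - g p‖ := by
    intro z hz
    have h1 := hlin z (sphere_subset_closedBall hz)
    have h2 : deriv g p * (z - p) =
      (g z - g p) - ((g z - deriv g p * z) - (g p - deriv g p * p)) := by ring
    have h3 := norm_sub_le (g z - g p) ((g z - deriv g p * z) - (g p - deriv g p * p))
    rw [← h2, norm_mul, ← hA] at h3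
    rw [mem_sphere_iff_norm] at hz
    rw [hz] at h1 h3
    nlinarith [mul_pos hA0 ht0]
  refine ⟨g p, ?_⟩
  have hsub8 : closedBall p (t / 8) ⊆ ball (0 : ℂ) 1 :=
    (closedBall_subset_ball (by linarith)).trans (hball.trans hsub)
  have hdp : HasDerivAt g (deriv g p) p := (hg.differentiableAt
        (isOpen_ball.mem_nhds (hsub hp))).hasDerivAt
  have := DiffContOnCl.ball_subset_image_closedBall (f := g) (z₀ := p) (r := t / 8)
    (ε := A * t / 16) ?_ (by positivity) hlow ?_
  · refine (ball_subset_ball ?_).trans (this.trans (Set.image_mono hsub8))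
    rw [ht]
    linarith
  · refine DifferentiableOn.diffContOnCl (hg.mono ?_)
    rw [closure_ball _ (by positivity)]
    exact hsub8
  · exact (hdp.eventually_ne (norm_pos_iff.1 hA0)).frequently.filter_mono nhdsWithin_le_nhds

open Metric in
/-- Holomorphic logarithms on the unit disk, with prescribed value at the center. -/
lemma exists_hasDerivAt_exp_eq {f : ℂ → ℂ} (hf : DifferentiableOn ℂ f (ball 0 1))
    (h0 : ∀ z ∈ ball (0 : ℂ) 1, f z ≠ 0) {y : ℂ} (hy : Complex.exp y = f 0) :
    ∃ L : ℂ → ℂ, L 0 = y ∧ ∀ z ∈ ball (0 : ℂ) 1,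
      HasDerivAt L (deriv f z / f z) z ∧ Complex.exp (L z) = f z := by
  obtain ⟨L, hL0, hL⟩ := (((hf.deriv isOpen_ball).div hf h0).isExactOn_ball).with_val_at 0 y
  refine ⟨L, hL0, fun z hz => ⟨hL z hz, ?_⟩⟩
  have hder : ∀ z ∈ ball (0 : ℂ) 1, HasDerivAt (fun z => Complex.exp (L z) / f z) 0 z := by
    intro z hz
    have h1 : HasDerivAt f (deriv f z) z :=
      (hf.differentiableAt (isOpen_ball.mem_nhds hz)).hasDerivAt
    have hfz := h0 z hz
    convert! (hL z hz).cexp.div h1 hfz using 1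
    simp only [Pi.div_apply]
    field_simp
    ring
  have hconst := isOpen_ball.is_const_of_deriv_eq_zero (convex_ball (0:ℂ) 1).isPreconnected
    (fun z hz => (hder z hz).differentiableAt.differentiableWithinAt)
    (fun z hz => (hder z hz).deriv) hz (mem_ball_self one_pos)
  simp only [hL0, hy] at hconst
  rw [div_self (h0 0 (mem_ball_self one_pos))] at hconst
  exact (div_eq_one_iff_eq (h0 z hz)).1 hconst

/-- The points where `cosh` takes natural number values are `2`-dense in `ℝ`. -/
lemma exists_cosh_eq_natCast (a : ℝ) : ∃ (x : ℝ) (n : ℕ), |x - a| ≤ 2 ∧ Real.cosh x = n := by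
  wlog ha : 0 ≤ a generalizing a
  · obtain ⟨x, n, hx, hn⟩ := this (-a) (by linarith)
    refine ⟨-x, n, ?_, by rwa [Real.cosh_neg]⟩
    rw [← abs_neg]
    convert hx using 2
    ring
  have hcosh2 : 2 ≤ Real.cosh 2 := by
    have h1 : (2 : ℝ) ≤ Real.exp 1 := by linarith [Real.add_one_le_exp (1 : ℝ)]
    have h2 : Real.exp 2 = Real.exp 1 * Real.exp 1 := by rw [← Real.exp_add]; norm_num
    have h3 := Real.exp_pos (-2)
    rw [Real.cosh_eq]
    nlinarith
  have hstep : Real.cosh a + 1 ≤ Real.cosh (a + 2) := by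
    rw [Real.cosh_add]
    have h1 := Real.one_le_cosh a
    have h2 : 0 ≤ Real.sinh a := Real.sinh_nonneg_iff.2 ha
    have h3 : 0 ≤ Real.sinh 2 := Real.sinh_nonneg_iff.2 (by norm_num)
    nlinarith [mul_nonneg h2 h3]
  obtain ⟨x, hx, hn⟩ := intermediate_value_Icc (by linarith : a ≤ a + 2)
    Real.continuous_cosh.continuousOn (show ((⌈Real.cosh a⌉₊ : ℕ) : ℝ) ∈ _ from
      ⟨Nat.le_ceil _, (Nat.ceil_lt_add_one (Real.cosh_pos a).le).le.trans hstep⟩)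
  exact ⟨x, _, by rw [abs_le]; constructor <;> linarith [hx.1, hx.2], hn⟩

/-- The points where `cosh` takes natural number values are `6`-dense in `ℂ`. -/
lemma exists_mem_ball_cosh_eq_natCast (q : ℂ) :
    ∃ p ∈ Metric.ball q 6, ∃ n : ℕ, Complex.cosh p = n := by
  obtain ⟨x, n, hx, hn⟩ := exists_cosh_eq_natCast q.re
  set m := round (q.im / (2 * Real.pi))
  refine ⟨x + m * (2 * Real.pi * Complex.I), ?_, n, ?_⟩
  · have hm : |2 * Real.pi * m - q.im| ≤ Real.pi := by
      have h1 := abs_sub_round (q.im / (2 * Real.pi))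
      have h2 : 2 * Real.pi * m - q.im = -(2 * Real.pi * (q.im / (2 * Real.pi) - m)) := by
        field_simp
        ring
      rw [h2, abs_neg, abs_mul, abs_of_pos Real.two_pi_pos]
      nlinarith [Real.pi_pos]
    rw [mem_ball_iff_norm]
    refine (Complex.norm_le_abs_re_add_abs_im _).trans_lt ?_
    have hre : (x + m * (2 * Real.pi * Complex.I) - q).re = x - q.re := by simp
    have him : (x + m * (2 * Real.pi * Complex.I) - q).im = 2 * Real.pi * m - q.im := by
      simp; ring
    rw [hre, him]
    linarith [Real.pi_lt_four]
  · rw [Complex.cosh, neg_add, ← neg_mul, ← Int.cast_neg, Complex.exp_add, Complex.exp_add,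
      Complex.exp_int_mul_two_pi_mul_I, Complex.exp_int_mul_two_pi_mul_I, mul_one, mul_one]
    rw [← Complex.cosh, ← Complex.ofReal_cosh, hn]
    simp

open Metric in
/-- A form of **Landau's theorem** for functions on the disk omitting all integers. -/
lemma norm_deriv_le_of_ne_intCast {F : ℂ → ℂ} (hF : DifferentiableOn ℂ F (ball 0 1))
    (hint : ∀ z ∈ ball (0 : ℂ) 1, ∀ n : ℤ, F z ≠ n) (him : (F 0).im = 0) :
    ‖deriv F 0‖ ≤ 768 := by
  wlog hre : 0 ≤ (F 0).re ∧ (F 0).re ≤ 1 generalizing F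
  · have := this (F := fun z => F z - ⌊(F 0).re⌋) (hF.sub_const _)
      (fun z hz n h => hint z hz (n + ⌊(F 0).re⌋) (by push_cast; linear_combination h))
      (by simpa using him)
      (by simp [(Int.fract_lt_one _).le])
    simpa [deriv_sub_const] using this
  have h0 : (0 : ℂ) ∈ ball (0 : ℂ) 1 := mem_ball_self one_pos
  have hsq : ∀ z ∈ ball (0 : ℂ) 1, F z ^ 2 - 1 ≠ 0 := by
    intro z hz h
    have : (F z - 1) * (F z + 1) = 0 := by linear_combination h
    rcases mul_eq_zero.1 this with h | h
    · exact hint z hz 1 (by push_cast; linear_combination h)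
    · exact hint z hz (-1) (by push_cast; linear_combination h)
  obtain ⟨L, -, hL⟩ := exists_hasDerivAt_exp_eq (f := fun z => F z ^ 2 - 1)
    ((hF.pow 2).sub_const 1) hsq (Complex.exp_log (hsq 0 h0))
  have hs : ∀ z ∈ ball (0 : ℂ) 1, Complex.exp (L z / 2) ^ 2 = F z ^ 2 - 1 := by
    intro z hz
    rw [← (hL z hz).2, ← Complex.exp_nat_mul]
    congr 1
    push_cast
    ring
  have hprod : ∀ z ∈ ball (0 : ℂ) 1,
      (F z + Complex.exp (L z / 2)) * (F z - Complex.exp (L z / 2)) = 1 := by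
    intro z hz
    linear_combination -hs z hz
  have hT : ∀ z ∈ ball (0 : ℂ) 1, F z + Complex.exp (L z / 2) ≠ 0 := by
    intro z hz h
    have := hprod z hz
    rw [h] at this
    simp at this
  have hLd : DifferentiableOn ℂ L (ball 0 1) := fun z hz =>
    (hL z hz).1.differentiableAt.differentiableWithinAt
  obtain ⟨g, -, hg⟩ := exists_hasDerivAt_exp_eq (f := fun z => F z + Complex.exp (L z / 2))
    (hF.add (hLd.div_const 2).cexp) hT (Complex.exp_log (hT 0 h0))
  have hcosh : ∀ z ∈ ball (0 : ℂ) 1, F z = Complex.cosh (g z) := by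
    intro z hz
    rw [Complex.cosh, Complex.exp_neg, (hg z hz).2, inv_eq_of_mul_eq_one_right (hprod z hz)]
    ring
  have hgd : DifferentiableOn ℂ g (ball 0 1) := fun z hz =>
    (hg z hz).1.differentiableAt.differentiableWithinAt
  have hg' : ‖deriv g 0‖ ≤ 768 := by
    obtain ⟨q, hq⟩ := exists_ball_subset_image_ball hgd
    by_contra! h
    obtain ⟨p, hp, n, hn⟩ := exists_mem_ball_cosh_eq_natCast q
    obtain ⟨z, hz, rfl⟩ := hq (ball_subset_ball (by linarith) hp)
    exact hint z hz n (by rw [hcosh z hz, hn]; simp)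
  have hFd : deriv F 0 = Complex.sinh (g 0) * deriv g 0 := by
    rw [(Filter.eventuallyEq_of_mem (isOpen_ball.mem_nhds h0) hcosh).deriv_eq]
    exact ((hgd.differentiableAt (isOpen_ball.mem_nhds h0)).hasDerivAt.ccosh).deriv
  have hsinh : ‖Complex.sinh (g 0)‖ ≤ 1 := by
    have h1 : Complex.sinh (g 0) ^ 2 = (((F 0).re ^ 2 - 1 : ℝ) : ℂ) := by
      rw [Complex.sinh_sq, ← hcosh 0 h0, ← Complex.re_add_im (F 0), him]
      simp
    have h2 : ‖Complex.sinh (g 0)‖ ^ 2 ≤ 1 := by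
      rw [← norm_pow, h1, Complex.norm_real, Real.norm_eq_abs, abs_le]
      constructor <;> nlinarith [hre.1, hre.2]
    exact (sq_le_one_iff₀ (norm_nonneg _)).1 h2
  rw [hFd, norm_mul]
  nlinarith [norm_nonneg (deriv g 0), norm_nonneg (Complex.sinh (g 0))]

open Metric in
/-- A form of **Landau's theorem** for functions on the disk omitting `0` and `1`. -/
lemma norm_deriv_zero_le_of_ne_zero_one {f : ℂ → ℂ} (hf : DifferentiableOn ℂ f (ball 0 1))
    (h0 : ∀ z ∈ ball (0 : ℂ) 1, f z ≠ 0) (h1 : ∀ z ∈ ball (0 : ℂ) 1, f z ≠ 1)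
    (hn : ‖f 0‖ = 1) : ‖deriv f 0‖ ≤ 1536 * Real.pi := by
  have hz0 : (0 : ℂ) ∈ ball (0 : ℂ) 1 := mem_ball_self one_pos
  obtain ⟨L, hL0, hL⟩ := exists_hasDerivAt_exp_eq hf h0 (Complex.exp_log (h0 0 hz0))
  have hpi : (2 * Real.pi * Complex.I : ℂ) ≠ 0 := Complex.two_pi_I_ne_zero
  have hF : ∀ z ∈ ball (0 : ℂ) 1, HasDerivAt (fun z => L z / (2 * Real.pi * Complex.I))
      (deriv f z / f z / (2 * Real.pi * Complex.I)) z := fun z hz => (hL z hz).1.div_const _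
  have := norm_deriv_le_of_ne_intCast
    (fun z hz => (hF z hz).differentiableAt.differentiableWithinAt) ?_ ?_
  · rw [(hF 0 hz0).deriv, norm_div, norm_div, hn, div_one, norm_mul, norm_mul, Complex.norm_I,
      Complex.norm_real, Real.norm_of_nonneg Real.pi_pos.le, Complex.norm_ofNat, mul_one,
      div_le_iff₀ Real.two_pi_pos] at this
    linarith
  · intro z hz n h
    apply h1 z hz
    rw [← (hL z hz).2, ← Complex.exp_int_mul_two_pi_mul_I n, ← h, div_mul_cancel₀ _ hpi]
  · have h2 : Complex.log (f 0) / (2 * Real.pi * Complex.I) =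
        ((Complex.arg (f 0) / (2 * Real.pi) : ℝ) : ℂ) := by
      rw [Complex.log, hn]
      push_cast
      rw [Real.log_one]
      field_simp
      simp
    rw [hL0, h2, Complex.ofReal_im]

open Metric in
/-- A form of **Landau's theorem** for functions on the disk omitting `0` and `1`, at points where
the function has modulus `1`. -/
lemma norm_deriv_le_of_ne_zero_one {f : ℂ → ℂ} (hf : DifferentiableOn ℂ f (ball 0 1))
    (h0 : ∀ z ∈ ball (0 : ℂ) 1, f z ≠ 0) (h1 : ∀ z ∈ ball (0 : ℂ) 1, f z ≠ 1)
    {c : ℂ} (hc : ‖c‖ < 1) (hn : ‖f c‖ = 1) :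
    (1 - ‖c‖ ^ 2) * ‖deriv f c‖ ≤ 2 * (1536 * Real.pi) := by
  set s := 1 - ‖c‖ with hs
  have hs0 : 0 < s := by linarith
  have hmem : ∀ z ∈ ball (0 : ℂ) 1, c + s * z ∈ ball (0 : ℂ) 1 := by
    intro z hz
    rw [mem_ball_zero_iff] at hz ⊢
    have h2 := norm_add_le c (s * z)
    rw [norm_mul, Complex.norm_real, Real.norm_of_nonneg hs0.le] at h2
    nlinarith
  have hd : HasDerivAt (fun z : ℂ => f (c + s * z)) (deriv f c * s) 0 := by
    have h2 : HasDerivAt f (deriv f c) (c + s * 0) := by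
      rw [mul_zero, add_zero]
      exact (hf.differentiableAt (isOpen_ball.mem_nhds (by simpa using hc))).hasDerivAt
    have h3 : HasDerivAt (fun z : ℂ => c + s * z) s 0 := by
      simpa using ((hasDerivAt_id (0 : ℂ)).const_mul (s : ℂ)).const_add c
    exact h2.comp 0 h3
  have := norm_deriv_zero_le_of_ne_zero_one (f := fun z => f (c + s * z))
    (hf.comp (by fun_prop) hmem) (fun z hz => h0 _ (hmem z hz)) (fun z hz => h1 _ (hmem z hz))
    (by simpa using hn)
  rw [hd.deriv, norm_mul, Complex.norm_real, Real.norm_of_nonneg hs0.le] at this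
  have h4 : (1 - ‖c‖ ^ 2) = s * (1 + ‖c‖) := by rw [hs]; ring
  rw [h4]
  nlinarith [norm_nonneg c, mul_nonneg (norm_nonneg (deriv f c)) hs0.le]

open Metric in
/-- A Harnack type inequality along radii for a function `W` satisfying the Schwarz–Pick derivative
bound of maps to the right half-plane on the set `Re W ≥ κ`. -/
lemma harnack_of_halfPlane_dilation_le {W : ℂ → ℂ} {κ r : ℝ} (hκ : 0 < κ)
    (hW : DifferentiableOn ℂ W (ball 0 1))
    (hb : ∀ c : ℂ, ‖c‖ < 1 → κ ≤ (W c).re → (1 - ‖c‖ ^ 2) * ‖deriv W c‖ ≤ 2 * (W c).re)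
    (hr : r < 1) (h0 : κ * ((1 + r) / (1 - r)) < (W 0).re) {c : ℂ} (hc : ‖c‖ ≤ r) :
    (1 - ‖c‖) / (1 + ‖c‖) * (W 0).re ≤ (W c).re := by
  have hr0 : 0 ≤ r := (norm_nonneg c).trans hc
  obtain ⟨u, hu, hcu⟩ : ∃ u : ℂ, ‖u‖ = 1 ∧ c = ‖c‖ * u := by
    rcases eq_or_ne c 0 with rfl | hne
    · exact ⟨1, by simp, by simp⟩
    · have : (‖c‖ : ℂ) ≠ 0 := by simpa using hne
      exact ⟨c / ‖c‖, by simp [hne], by field_simp⟩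
  set g : ℝ → ℝ := fun t => (W (t * u)).re with hg
  set q : ℝ → ℝ := fun t => g t * ((1 + t) / (1 - t)) with hq
  have hnorm : ∀ t : ℝ, 0 ≤ t → ‖(t : ℂ) * u‖ = t := by
    intro t ht
    rw [norm_mul, hu, mul_one, Complex.norm_real, Real.norm_of_nonneg ht]
  have hgd : ∀ t ∈ Set.Icc 0 r, HasDerivAt g (deriv W (t * u) * u).re t := by
    intro t ht
    have hlt : ‖(t : ℂ) * u‖ < 1 := by rw [hnorm t ht.1]; linarith [ht.2]
    have h1 : HasDerivAt W (deriv W (t * u)) (t * u) :=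
      (hW.differentiableAt (isOpen_ball.mem_nhds (by simpa using hlt))).hasDerivAt
    have h2 : HasDerivAt (fun t : ℂ => t * u) u (t : ℂ) := by
      simpa using (hasDerivAt_id (t : ℂ)).mul_const u
    exact (h1.comp (t : ℂ) h2).real_of_complex
  have hqd : ∀ t ∈ Set.Icc 0 r, HasDerivAt q
      (((1 - t ^ 2) * (deriv W (t * u) * u).re + 2 * g t) / (1 - t) ^ 2) t := by
    intro t ht
    have hne : 1 - t ≠ 0 := by linarith [ht.2]
    have h2 : HasDerivAt (fun t : ℝ => (1 + t) / (1 - t)) (2 / (1 - t) ^ 2) t := by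
      convert! ((hasDerivAt_id t).const_add 1).div ((hasDerivAt_id t).const_sub 1) hne using 1
      simp
      ring
    convert! (hgd t ht).mul h2 using 1
    field_simp
    ring
  have hmono : ∀ T ∈ Set.Icc 0 r, (∀ t ∈ Set.Icc 0 T, κ ≤ g t) → q 0 ≤ q T := by
    intro T hT hκT
    have hsub : Set.Icc 0 T ⊆ Set.Icc 0 r := Set.Icc_subset_Icc_right hT.2
    refine monotoneOn_of_deriv_nonneg (convex_Icc 0 T)
      (fun t ht => (hqd t (hsub ht)).continuousAt.continuousWithinAt)
      (fun t ht => (hqd t (hsub (interior_subset ht))).differentiableAt.differentiableWithinAt)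
      (fun t ht => ?_) (Set.left_mem_Icc.2 hT.1) (Set.right_mem_Icc.2 hT.1) hT.1
    have ht' := interior_subset ht
    have ht1 : t < 1 := ht'.2.trans_lt (hT.2.trans_lt hr)
    rw [(hqd t (hsub ht')).deriv]
    refine div_nonneg ?_ (sq_nonneg _)
    have h3 := hb (t * u) (by rw [hnorm t ht'.1]; exact ht1) (hκT t ht')
    rw [hnorm t ht'.1] at h3
    have h4 : -‖deriv W (t * u)‖ ≤ (deriv W (t * u) * u).re := by
      have := (abs_le.1 (Complex.abs_re_le_norm (deriv W (t * u) * u))).1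
      rwa [norm_mul, hu, mul_one] at this
    have h5 : 0 ≤ 1 - t ^ 2 := by nlinarith [ht'.1]
    have h6 : (W (t * u)).re = g t := rfl
    rw [h6] at h3
    nlinarith [mul_le_mul_of_nonneg_left h4 h5]
  have hq0 : q 0 = (W 0).re := by simp [hq, hg]
  have hlarge : ∀ t ∈ Set.Icc 0 r, κ ≤ g t := by
    by_contra! hex
    obtain ⟨t₀, ht₀, hgt₀⟩ := hex
    have hcont : ContinuousOn g (Set.Icc 0 r) :=
      fun t ht => (hgd t ht).continuousAt.continuousWithinAt
    have hScpt : IsCompact (Set.Icc 0 r ∩ g ⁻¹' Set.Iic κ) :=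
      isCompact_Icc.of_isClosed_subset (hcont.preimage_isClosed_of_isClosed isClosed_Icc isClosed_Iic)
        Set.inter_subset_left
    obtain ⟨T, hTS, hTmin⟩ := hScpt.exists_isLeast ⟨t₀, ht₀, hgt₀.le⟩
    have hbefore : ∀ t ∈ Set.Ico 0 T, κ < g t := by
      intro t ht
      by_contra! h
      exact absurd (hTmin ⟨⟨ht.1, ht.2.le.trans hTS.1.2⟩, h⟩) (not_le.2 ht.2)
    have hg0 : κ < g 0 := by
      have h1 : (1 : ℝ) ≤ (1 + r) / (1 - r) := by rw [le_div_iff₀ (by linarith)]; linarith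
      have h2 : g 0 = (W 0).re := by simp [hg]
      rw [h2]
      nlinarith
    have hT0 : 0 < T := by
      refine lt_of_le_of_ne hTS.1.1 fun h => ?_
      have h1 : g T ≤ κ := hTS.2
      rw [← h] at h1
      linarith
    have hgT : κ ≤ g T := by
      refine ge_of_tendsto (b := κ) (f := g) (x := nhdsWithin T (Set.Iio T))
        ((hgd T hTS.1).continuousAt.tendsto.mono_left nhdsWithin_le_nhds) ?_
      filter_upwards [Ico_mem_nhdsLT hT0] with t ht using (hbefore t ht).le
    have h1 := hmono T hTS.1 (fun t ht => by
      rcases eq_or_lt_of_le ht.2 with h | h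
      · rw [h]; exact hgT
      · exact (hbefore t ⟨ht.1, h⟩).le)
    have h2 : q T ≤ κ * ((1 + r) / (1 - r)) := by
      have h3 : g T ≤ κ := hTS.2
      have h4 : (1 + T) / (1 - T) ≤ (1 + r) / (1 - r) := by
        have := hTS.1.2
        rw [div_le_div_iff₀ (by linarith) (by linarith)]
        nlinarith
      have h5 : 0 ≤ (1 + T) / (1 - T) := by
        have := hTS.1.2
        exact div_nonneg (by linarith) (by linarith)
      exact mul_le_mul h3 h4 h5 hκ.le
    rw [hq0] at h1
    linarith
  have hfin := hmono ‖c‖ ⟨norm_nonneg c, hc⟩ fun t ht => hlarge t ⟨ht.1, ht.2.trans hc⟩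
  have hgc : g ‖c‖ = (W c).re := by
    change (W (‖c‖ * u)).re = _
    rw [← hcu]
  rw [hq0] at hfin
  change _ ≤ g ‖c‖ * _ at hfin
  rw [hgc] at hfin
  have hc1 : 0 < 1 - ‖c‖ := by linarith
  have hc2 : 0 < 1 + ‖c‖ := by positivity
  rw [mul_div_assoc', le_div_iff₀ hc1] at hfin
  rw [div_mul_eq_mul_div, div_le_iff₀ hc2]
  linarith

open Metric in
/-- A form of **Schottky's theorem** with the sharp exponent: a holomorphic function on the unit disk
omitting `0` and `1` and sufficiently small at the origin satisfies a Hölder type bound. -/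
lemma norm_le_rpow_of_ne_zero_one {r : ℝ} (hr : r < 1) :
    ∃ δ M : ℝ, 0 < δ ∧ 0 < M ∧ ∀ f : ℂ → ℂ, DifferentiableOn ℂ f (ball 0 1) →
      (∀ z ∈ ball (0 : ℂ) 1, f z ≠ 0) → (∀ z ∈ ball (0 : ℂ) 1, f z ≠ 1) → ‖f 0‖ < δ →
      ∀ c : ℂ, ‖c‖ ≤ r → ‖f c‖ ≤ M * ‖f 0‖ ^ ((1 - ‖c‖) / (1 + ‖c‖)) := by
  set K := 1536 * Real.pi with hK
  have hK0 : 0 < K := by positivity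
  refine ⟨Real.exp (K - K * ((1 + r) / (1 - r))), Real.exp K, Real.exp_pos _, Real.exp_pos _, ?_⟩
  intro f hf h0 h1 hδ c hc
  have hz0 : (0 : ℂ) ∈ ball (0 : ℂ) 1 := mem_ball_self one_pos
  have hc1 : ‖c‖ < 1 := hc.trans_lt hr
  obtain ⟨L, -, hL⟩ := exists_hasDerivAt_exp_eq hf h0 (Complex.exp_log (h0 0 hz0))
  have hnorm : ∀ z ∈ ball (0 : ℂ) 1, ‖f z‖ = Real.exp (L z).re := by
    intro z hz
    rw [← (hL z hz).2, Complex.norm_exp]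
  have hWd : ∀ z ∈ ball (0 : ℂ) 1, HasDerivAt (fun z => K - L z) (-(deriv f z / f z)) z :=
    fun z hz => (hL z hz).1.const_sub _
  have hW : DifferentiableOn ℂ (fun z => K - L z) (ball 0 1) :=
    fun z hz => (hWd z hz).differentiableAt.differentiableWithinAt
  have hre : ∀ z : ℂ, (K - L z).re = K - (L z).re := fun z => by simp
  have hlevel : ∀ z : ℂ, ‖z‖ < 1 → (K - L z).re = K →
      (1 - ‖z‖ ^ 2) * ‖deriv (fun z => K - L z) z‖ ≤ 2 * K := by
    intro z hz hLz
    have hzb : z ∈ ball (0 : ℂ) 1 := by simpa using hz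
    have hn : ‖f z‖ = 1 := by
      rw [hre] at hLz
      rw [hnorm z hzb, Real.exp_eq_one_iff]
      linarith
    rw [(hWd z hzb).deriv, norm_neg, norm_div, hn, div_one]
    exact norm_deriv_le_of_ne_zero_one hf h0 h1 hz hn
  have hL0 : (L 0).re < K - K * ((1 + r) / (1 - r)) := by
    rwa [hnorm 0 hz0, Real.exp_lt_exp] at hδ
  have := harnack_of_halfPlane_dilation_le hK0 hW
    (fun z hz hκ => halfPlane_dilation_le hK0 hW hlevel hz hκ) hr
    (by rw [hre]; linarith) hc
  rw [hre, hre] at this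
  set e := (1 - ‖c‖) / (1 + ‖c‖)
  have he : 0 ≤ e := div_nonneg (by linarith) (by positivity)
  rw [hnorm c (by simpa using hc1), hnorm 0 hz0, ← Real.exp_mul, ← Real.exp_add, Real.exp_le_exp]
  nlinarith [mul_nonneg he hK0.le]

/-- Hölder continuity of the time-`c` maps of a normalized holomorphic
motion of `ℂ` (fixing `0` and `1`, each time-`c` map a bijection of `ℂ`): for
`0 < r < 1` and `R > 0` there is `C > 0` such that whenever the trajectories of `z₁`
and `z₂` stay in the disk of radius `R` for `|c| ≤ r`, one has
`|h(c,z₂) - h(c,z₁)| ≤ C |z₂ - z₁|^((1-|c|)/(1+|c|))` for all `|c| ≤ r`. -/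
theorem holomorphicMotion_holder
    (h : ℂ → ℂ → ℂ) (hmot : IsHolomorphicMotion 1 Set.univ h)
    (hnorm0 : ∀ c ∈ Metric.ball (0 : ℂ) 1, h c 0 = 0)
    (hnorm1 : ∀ c ∈ Metric.ball (0 : ℂ) 1, h c 1 = 1)
    (hbij : ∀ c ∈ Metric.ball (0 : ℂ) 1, Function.Bijective (fun z => h c z))
    (r R : ℝ) (hr0 : 0 < r) (hr1 : r < 1) (hR : 0 < R) :
    ∃ C : ℝ, 0 < C ∧
      ∀ z₁ z₂ : ℂ,
        (∀ c : ℂ, ‖c‖ ≤ r → ‖h c z₁‖ ≤ R ∧ ‖h c z₂‖ ≤ R) →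
        ∀ c : ℂ, ‖c‖ ≤ r →
          ‖h c z₂ - h c z₁‖ ≤ C * ‖z₂ - z₁‖ ^ ((1 - ‖c‖) / (1 + ‖c‖)) := by
  obtain ⟨hbase, hinj, hhol⟩ := hmot
  obtain ⟨δ, M, hδ, hM, hSch⟩ := norm_le_rpow_of_ne_zero_one hr1
  set η := min (1 / 2) (δ / 2) with hη
  have hη0 : 0 < η := by positivity
  have hη1 : η ≤ 1 / 2 := min_le_left _ _
  have hη2 : η ≤ δ / 2 := min_le_right _ _
  refine ⟨max (2 * R / η) (2 * M * (1 + R)), by positivity, fun z₁ z₂ hbd c hc => ?_⟩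
  have hc1 : ‖c‖ < 1 := hc.trans_lt hr1
  have hcb : c ∈ Metric.ball (0 : ℂ) 1 := by simpa using hc1
  set e := (1 - ‖c‖) / (1 + ‖c‖) with he
  have he0 : 0 ≤ e := div_nonneg (by linarith) (by positivity)
  have he1 : e ≤ 1 := by
    rw [he, div_le_one (by positivity)]
    linarith [norm_nonneg c]
  rcases eq_or_ne z₁ z₂ with rfl | hne
  · rw [sub_self, norm_zero]
    positivity
  rcases le_or_gt η ‖z₂ - z₁‖ with hfar | hnear
  · have h1 : η ≤ ‖z₂ - z₁‖ ^ e :=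
      calc η = η ^ (1 : ℝ) := (Real.rpow_one η).symm
        _ ≤ η ^ e := Real.rpow_le_rpow_of_exponent_ge hη0 (by linarith) he1
        _ ≤ ‖z₂ - z₁‖ ^ e := Real.rpow_le_rpow hη0.le hfar he0
    calc ‖h c z₂ - h c z₁‖ ≤ ‖h c z₂‖ + ‖h c z₁‖ := norm_sub_le _ _
      _ ≤ 2 * R := by linarith [(hbd c hc).1, (hbd c hc).2]
      _ = 2 * R / η * η := by field_simp
      _ ≤ _ := mul_le_mul (le_max_left _ _) h1 hη0.le (by positivity)
  obtain ⟨z₃, hz₃, hz₃h, hz₃b⟩ : ∃ z₃ : ℂ, 1 / 2 ≤ ‖z₃ - z₁‖ ∧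
      (∀ c ∈ Metric.ball (0 : ℂ) 1, h c z₃ = z₃) ∧ ‖z₃‖ ≤ 1 := by
    rcases le_or_gt (1 / 2) ‖(0 : ℂ) - z₁‖ with h | h
    · exact ⟨0, h, hnorm0, by simp⟩
    · refine ⟨1, ?_, hnorm1, by simp⟩
      have := norm_sub_norm_le (1 : ℂ) z₁
      rw [zero_sub, norm_neg] at h
      rw [norm_one] at this
      linarith
  have h31 : z₃ ≠ z₁ := by
    rintro rfl
    norm_num at hz₃
  have h32 : z₃ ≠ z₂ := by
    rintro rfl
    linarith
  have hsub : ∀ {a b : ℂ}, a ≠ b → ∀ w ∈ Metric.ball (0 : ℂ) 1, h w a - h w b ≠ 0 :=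
    fun hab w hw heq =>
      hab (hinj w hw (Set.mem_univ _) (Set.mem_univ _) (sub_eq_zero.1 heq))
  have hd : ∀ a : ℂ, DifferentiableOn ℂ (fun w => h w a) (Metric.ball 0 1) :=
    fun a => hhol a (Set.mem_univ a)
  set f : ℂ → ℂ := fun w => (h w z₂ - h w z₁) / (h w z₃ - h w z₁) with hf
  have hf0 : ‖f 0‖ ≤ 2 * ‖z₂ - z₁‖ := by
    have : f 0 = (z₂ - z₁) / (z₃ - z₁) := by simp [hf, hbase]
    rw [this, norm_div, div_le_iff₀ (by linarith)]
    nlinarith [norm_nonneg (z₂ - z₁)]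
  have hfc := hSch f (((hd z₂).sub (hd z₁)).div ((hd z₃).sub (hd z₁)) (hsub h31))
    (fun w hw => div_ne_zero (hsub hne.symm w hw) (hsub h31 w hw))
    (fun w hw heq => by
      rw [hf] at heq
      simp only at heq
      rw [div_eq_one_iff_eq (hsub h31 w hw)] at heq
      exact hsub h32 w hw (by linear_combination -heq))
    (by linarith) c hc
  have h3 : ‖h c z₃ - h c z₁‖ ≤ 1 + R := by
    refine (norm_sub_le _ _).trans ?_
    rw [hz₃h c hcb]
    linarith [(hbd c hc).1]
  have hpow : ‖f 0‖ ^ e ≤ 2 * ‖z₂ - z₁‖ ^ e :=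
    calc ‖f 0‖ ^ e ≤ (2 * ‖z₂ - z₁‖) ^ e := Real.rpow_le_rpow (norm_nonneg _) hf0 he0
      _ = 2 ^ e * ‖z₂ - z₁‖ ^ e := Real.mul_rpow (by norm_num) (norm_nonneg _)
      _ ≤ 2 ^ (1 : ℝ) * ‖z₂ - z₁‖ ^ e := by
        gcongr
        norm_num
      _ = _ := by rw [Real.rpow_one]
  calc ‖h c z₂ - h c z₁‖ = ‖f c‖ * ‖h c z₃ - h c z₁‖ := by
        rw [← norm_mul, hf, div_mul_cancel₀ _ (hsub h31 c hcb)]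
    _ ≤ (M * (2 * ‖z₂ - z₁‖ ^ e)) * (1 + R) :=
        mul_le_mul (hfc.trans (mul_le_mul_of_nonneg_left hpow hM.le)) h3 (norm_nonneg _)
          (by positivity)
    _ = (2 * M * (1 + R)) * ‖z₂ - z₁‖ ^ e := by ring
    _ ≤ _ := mul_le_mul_of_nonneg_right (le_max_right _ _) (by positivity)
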